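/- Let F be a proper filter in S such that d(F) ∩ E is an E-ultrafilter. Then F is an ultrafilter in S. (Consequently, the filters-to-germs isomorphism maps the set of ultrafilters onto the set of ultragerms.) -/

import Mathlib

/-- An inverse semigroup with zero: every element `a` has a unique `a⁻¹` with
`a * a⁻¹ * a = a` and `a⁻¹ * a * a⁻¹ = a⁻¹`, and `0` is absorbing. -/
class InvSemigroupWithZero (S : Type*) extends Semigroup S, Zero S, Inv S where
  mul_inv_mul : ∀ a : S, a * a⁻¹ * a = a
  inv_mul_inv : ∀ a : S, a⁻¹ * a * a⁻¹ = a⁻¹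
  inv_unique : ∀ a b : S, a * b * a = a → b * a * b = b → b = a⁻¹
  zero_mul : ∀ a : S, 0 * a = 0
  mul_zero : ∀ a : S, a * 0 = 0

namespace InvSemigroupWithZero

variable {S : Type*} [InvSemigroupWithZero S]

/-- The natural partial order on `S`: `a ≤ b` iff `a = a * a⁻¹ * b`. -/
def sle (a b : S) : Prop := a = a * a⁻¹ * b

/-- `↓s`, the down-set of `s` w.r.t. the natural partial order. -/
def dwn (s : S) : Set S := {t : S | sle t s}

/-- `↑A`, the up-set generated by `A` w.r.t. the natural partial order. -/
def up (A : Set S) : Set S := {b : S | ∃ a ∈ A, sle a b}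

/-- A filter in `S`: a nonempty down-directed up-set. -/
def IsFilt (F : Set S) : Prop :=
  F.Nonempty ∧ up F = F ∧ ∀ a ∈ F, ∀ b ∈ F, ∃ c ∈ F, sle c a ∧ sle c b

/-- A proper filter: a filter not containing `0`. -/
def IsPFilt (F : Set S) : Prop := IsFilt F ∧ (0 : S) ∉ F

/-- An ultrafilter: a proper filter maximal among proper filters. -/
def IsUltra (U : Set S) : Prop :=
  IsPFilt U ∧ ∀ G : Set S, IsPFilt G → U ⊆ G → U = G

/-- The set `E` of idempotents of `S`. -/
def E (S : Type*) [InvSemigroupWithZero S] : Set S := {e : S | e * e = e}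

/-- `F⁻¹ = {a⁻¹ : a ∈ F}`. -/
def finv (F : Set S) : Set S := (fun a : S => a⁻¹) '' F

/-- `F · G = ↑{fg : f ∈ F, g ∈ G}`. -/
def fmul (F G : Set S) : Set S := up (Set.image2 (· * ·) F G)

/-- The source `d(F) := F⁻¹ · F`. -/
def src (F : Set S) : Set S := fmul (finv F) F

/-- The range `r(F) := F · F⁻¹`. -/
def rng (F : Set S) : Set S := fmul F (finv F)

/-- The natural partial order on the idempotents: `e ≤ f` iff `e = e * f`. -/
def ele (e f : S) : Prop := e = e * f

/-- The down-set of an idempotent `e` inside `E`. -/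
def edwn (e : S) : Set S := {f : S | f ∈ E S ∧ ele f e}

/-- The up-set generated by `A` inside `E`. -/
def eup (A : Set S) : Set S := {f : S | f ∈ E S ∧ ∃ a ∈ A, ele a f}

/-- An `E`-filter: a proper filter of the inverse semigroup `E` of idempotents. -/
def IsEFilt (ξ : Set S) : Prop :=
  ξ ⊆ E S ∧ ξ.Nonempty ∧ eup ξ = ξ ∧
    (∀ a ∈ ξ, ∀ b ∈ ξ, ∃ c ∈ ξ, ele c a ∧ ele c b) ∧ (0 : S) ∉ ξ

/-- An `E`-ultrafilter: an `E`-filter maximal among `E`-filters. -/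
def IsEUltra (ξ : Set S) : Prop :=
  IsEFilt ξ ∧ ∀ η : Set S, IsEFilt η → ξ ⊆ η → ξ = η

/-- `β_s(ξ) = {f ∈ E : s·e·s⁻¹ ≤ f for some e ∈ ξ}`. -/
def beta (s : S) (ξ : Set S) : Set S :=
  {f : S | f ∈ E S ∧ ∃ e ∈ ξ, sle (s * e * s⁻¹) f}

/-- The set of proper filters in `S`. -/
abbrev PFilt (S : Type*) [InvSemigroupWithZero S] := {F : Set S // IsPFilt F}

/-- The patch topology on the set of proper filters, generated by the sets
`F(s;T) = {F : s ∈ F, F ∩ T = ∅}` for `s ∈ S` and finite `T ⊆ ↓s`. -/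
instance patchTopology : TopologicalSpace (PFilt S) :=
  TopologicalSpace.generateFrom
    {O : Set (PFilt S) | ∃ (s : S) (T : Set S), T.Finite ∧ T ⊆ dwn s ∧
      O = {F : PFilt S | s ∈ F.1 ∧ F.1 ∩ T = ∅}}

/-- The set of idempotent proper filters in `S`. -/
abbrev IPFilt (S : Type*) [InvSemigroupWithZero S] :=
  {F : Set S // IsPFilt F ∧ (F ∩ E S).Nonempty}

/-- The subspace topology induced by the patch topology on proper filters. -/
instance : TopologicalSpace (IPFilt S) :=
  TopologicalSpace.induced (fun F => (⟨F.1, F.2.1⟩ : PFilt S)) inferInstance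

/-- The set of `E`-filters. -/
abbrev EFilt (S : Type*) [InvSemigroupWithZero S] := {ξ : Set S // IsEFilt ξ}

/-- The patch topology on the set of `E`-filters, generated by the sets
`P(e;X) = {ξ : e ∈ ξ, ξ ∩ X = ∅}` for `e ∈ E` and finite `X ⊆ ↓e ∩ E`. -/
instance : TopologicalSpace (EFilt S) :=
  TopologicalSpace.generateFrom
    {O : Set (EFilt S) | ∃ (e : S) (X : Set S), e ∈ E S ∧ X.Finite ∧ X ⊆ edwn e ∧
      O = {ξ : EFilt S | e ∈ ξ.1 ∧ ξ.1 ∩ X = ∅}}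

/-- The set of ultrafilters in `S`. -/
abbrev UFilt (S : Type*) [InvSemigroupWithZero S] := {U : Set S // IsUltra U}

/-- The subspace topology induced by the patch topology on proper filters. -/
instance : TopologicalSpace (UFilt S) :=
  TopologicalSpace.induced (fun U => (⟨U.1, U.2.1⟩ : PFilt S)) inferInstance

end InvSemigroupWithZero

open InvSemigroupWithZero

namespace InvSemigroupWithZero

variable {S : Type*} [InvSemigroupWithZero S]

theorem inverse_inverse (a : S) : a⁻¹⁻¹ = a :=
  (inv_unique _ _ (inv_mul_inv a) (mul_inv_mul a)).symm

theorem inverse_of_mem_E {e : S} (he : e ∈ E S) : e⁻¹ = e := by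
  have he' : e * e = e := he
  exact (inv_unique e e (by rw [he', he']) (by rw [he', he'])).symm

theorem inv_mul_self_mem_E (a : S) : a⁻¹ * a ∈ E S := by
  change a⁻¹ * a * (a⁻¹ * a) = a⁻¹ * a
  rw [← mul_assoc, inv_mul_inv]

theorem mul_inv_self_mem_E (a : S) : a * a⁻¹ ∈ E S := by
  change a * a⁻¹ * (a * a⁻¹) = a * a⁻¹
  rw [← mul_assoc, mul_inv_mul]

theorem mul_mem_E {e f : S} (he : e ∈ E S) (hf : f ∈ E S) : e * f ∈ E S := by
  have he' : e * e = e := he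
  have hf' : f * f = f := hf
  have h₁ := mul_inv_mul (e * f)
  have h₂ := inv_mul_inv (e * f)
  have hx : f * (e * f)⁻¹ * e = (e * f)⁻¹ := by
    apply inv_unique
    · calc e * f * (f * (e * f)⁻¹ * e) * (e * f)
          = e * (f * f) * (e * f)⁻¹ * ((e * e) * f) := by simp only [mul_assoc]
        _ = e * f := by rw [he', hf', h₁]
    · calc f * (e * f)⁻¹ * e * (e * f) * (f * (e * f)⁻¹ * e)
          = f * ((e * f)⁻¹ * ((e * e) * (f * f)) * (e * f)⁻¹) * e := by simp only [mul_assoc]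
        _ = f * (e * f)⁻¹ * e := by rw [he', hf', h₂]
  have hxx : (e * f)⁻¹ ∈ E S := by
    change (e * f)⁻¹ * (e * f)⁻¹ = (e * f)⁻¹
    calc (e * f)⁻¹ * (e * f)⁻¹
        = (f * (e * f)⁻¹ * e) * (f * (e * f)⁻¹ * e) := by rw [hx]
      _ = f * ((e * f)⁻¹ * (e * f) * (e * f)⁻¹) * e := by simp only [mul_assoc]
      _ = (e * f)⁻¹ := by rw [h₂, hx]
  have h := inverse_of_mem_E hxx
  rw [inverse_inverse] at h
  rwa [h]

theorem mul_comm_of_mem_E {e f : S} (he : e ∈ E S) (hf : f ∈ E S) : e * f = f * e := by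
  have he' : e * e = e := he
  have hf' : f * f = f := hf
  have hef : e * f * (e * f) = e * f := mul_mem_E he hf
  have hfe : f * e * (f * e) = f * e := mul_mem_E hf he
  have h : f * e = (e * f)⁻¹ := by
    apply inv_unique
    · calc e * f * (f * e) * (e * f) = e * (f * f) * ((e * e) * f) := by simp only [mul_assoc]
        _ = e * f := by rw [he', hf', hef]
    · calc f * e * (e * f) * (f * e) = f * (e * e) * ((f * f) * e) := by simp only [mul_assoc]
        _ = f * e := by rw [he', hf', hfe]
  rw [h, inverse_of_mem_E (mul_mem_E he hf)]

theorem inverse_mul (a b : S) : (a * b)⁻¹ = b⁻¹ * a⁻¹ := by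
  have hc := mul_comm_of_mem_E (mul_inv_self_mem_E b) (inv_mul_self_mem_E a)
  symm
  apply inv_unique
  · calc a * b * (b⁻¹ * a⁻¹) * (a * b)
        = a * ((b * b⁻¹) * (a⁻¹ * a)) * b := by simp only [mul_assoc]
      _ = (a * a⁻¹ * a) * (b * b⁻¹ * b) := by rw [hc]; simp only [mul_assoc]
      _ = a * b := by rw [mul_inv_mul, mul_inv_mul]
  · calc b⁻¹ * a⁻¹ * (a * b) * (b⁻¹ * a⁻¹)
        = b⁻¹ * ((a⁻¹ * a) * (b * b⁻¹)) * a⁻¹ := by simp only [mul_assoc]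
      _ = (b⁻¹ * b * b⁻¹) * (a⁻¹ * a * a⁻¹) := by rw [← hc]; simp only [mul_assoc]
      _ = b⁻¹ * a⁻¹ := by rw [inv_mul_inv, inv_mul_inv]

theorem conj_mem_E (a : S) {e : S} (he : e ∈ E S) : a * e * a⁻¹ ∈ E S := by
  have he' : e * e = e := he
  change a * e * a⁻¹ * (a * e * a⁻¹) = a * e * a⁻¹
  calc a * e * a⁻¹ * (a * e * a⁻¹)
      = a * (e * (a⁻¹ * a)) * e * a⁻¹ := by simp only [mul_assoc]
    _ = (a * a⁻¹ * a) * (e * e) * a⁻¹ := by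
        rw [mul_comm_of_mem_E he (inv_mul_self_mem_E a)]; simp only [mul_assoc]
    _ = a * e * a⁻¹ := by rw [he', mul_inv_mul]

theorem conj_mul_self (a : S) {e : S} (he : e ∈ E S) : a * e * a⁻¹ * a = a * e := by
  calc a * e * a⁻¹ * a = a * (e * (a⁻¹ * a)) := by simp only [mul_assoc]
    _ = (a * a⁻¹ * a) * e := by
        rw [mul_comm_of_mem_E he (inv_mul_self_mem_E a)]; simp only [mul_assoc]
    _ = a * e := by rw [mul_inv_mul]

theorem sle_mul_left {e : S} (he : e ∈ E S) (b : S) : sle (e * b) b := by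
  have he' : e * e = e := he
  change e * b = e * b * (e * b)⁻¹ * b
  symm
  calc e * b * (e * b)⁻¹ * b = e * ((b * b⁻¹) * e) * b := by
        rw [inverse_mul, inverse_of_mem_E he]; simp only [mul_assoc]
    _ = (e * e) * (b * b⁻¹ * b) := by
        rw [mul_comm_of_mem_E (mul_inv_self_mem_E b) he]; simp only [mul_assoc]
    _ = e * b := by rw [he', mul_inv_mul]

theorem sle_mul_right {e : S} (he : e ∈ E S) (b : S) : sle (b * e) b := by
  rw [← conj_mul_self b he]
  exact sle_mul_left (conj_mem_E b he) b

theorem sle.eq_mul_inv_mul {a b : S} (h : sle a b) : a = b * (a⁻¹ * a) := by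
  have h' : a = a * a⁻¹ * b := h
  have he := mul_inv_self_mem_E a
  have he' : a * a⁻¹ * (a * a⁻¹) = a * a⁻¹ := he
  symm
  calc b * (a⁻¹ * a) = b * ((a * a⁻¹ * b)⁻¹ * (a * a⁻¹ * b)) := by rw [← h']
    _ = b * b⁻¹ * ((a * a⁻¹) * (a * a⁻¹)) * b := by
        rw [inverse_mul, inverse_of_mem_E he]; simp only [mul_assoc]
    _ = a * a⁻¹ * (b * b⁻¹ * b) := by
        rw [he', mul_comm_of_mem_E (mul_inv_self_mem_E b) he]; simp only [mul_assoc]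
    _ = a := by rw [mul_inv_mul, ← h']

theorem sle.trans {a b c : S} (hab : sle a b) (hbc : sle b c) : sle a c := by
  have h₁ : a = a * a⁻¹ * b := hab
  have h₂ : b = b * b⁻¹ * c := hbc
  have h : a = a * a⁻¹ * (b * b⁻¹) * c := by rw [mul_assoc, ← h₂, ← h₁]
  rw [h]
  exact sle_mul_left (mul_mem_E (mul_inv_self_mem_E a) (mul_inv_self_mem_E b)) c

theorem sle_iff_ele {e f : S} (he : e ∈ E S) : sle e f ↔ ele e f := by
  have he' : e * e = e := he
  rw [sle, ele, inverse_of_mem_E he, he']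

theorem sle.inv_mul_le {a b c : S} (ha : sle c a) (hb : sle c b) :
    sle (c⁻¹ * c) (a⁻¹ * b) := by
  have hE := inv_mul_self_mem_E c
  have h : c⁻¹ * c = c⁻¹ * c * (a⁻¹ * b) * (c⁻¹ * c) := by
    calc c⁻¹ * c = (a * (c⁻¹ * c))⁻¹ * (b * (c⁻¹ * c)) := by
          rw [← ha.eq_mul_inv_mul, ← hb.eq_mul_inv_mul]
      _ = c⁻¹ * c * (a⁻¹ * b) * (c⁻¹ * c) := by
          rw [inverse_mul, inverse_of_mem_E hE]; simp only [mul_assoc]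
  rw [h]
  exact (sle_mul_right hE _).trans (sle_mul_left hE _)

theorem mem_src_inter_E_iff {F : Set S} (hF : IsFilt F) {e : S} :
    e ∈ src F ∩ E S ↔ e ∈ E S ∧ ∃ a ∈ F, ele (a⁻¹ * a) e := by
  constructor
  · rintro ⟨⟨_, ⟨_, ⟨a, ha, rfl⟩, b, hb, rfl⟩, hle⟩, he⟩
    obtain ⟨c, hc, hca, hcb⟩ := hF.2.2 a ha b hb
    exact ⟨he, c, hc, (sle_iff_ele (inv_mul_self_mem_E c)).1 ((hca.inv_mul_le hcb).trans hle)⟩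
  · rintro ⟨he, a, ha, hle⟩
    exact ⟨⟨_, ⟨_, ⟨a, ha, rfl⟩, a, ha, rfl⟩, (sle_iff_ele (inv_mul_self_mem_E a)).2 hle⟩, he⟩

theorem IsFilt.inv_mul_self_mem_src {F : Set S} (hF : IsFilt F) {a : S} (ha : a ∈ F) :
    a⁻¹ * a ∈ src F ∩ E S :=
  (mem_src_inter_E_iff hF).2 ⟨inv_mul_self_mem_E a, a, ha, (inv_mul_self_mem_E a).symm⟩

theorem IsPFilt.isEFilt_src {F : Set S} (hF : IsPFilt F) : IsEFilt (src F ∩ E S) := by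
  have hF' := hF.1
  refine ⟨Set.inter_subset_right, ?_, ?_, ?_, ?_⟩
  · obtain ⟨a, ha⟩ := hF'.1
    exact ⟨_, hF'.inv_mul_self_mem_src ha⟩
  · ext f
    constructor
    · rintro ⟨hf, e, ⟨⟨x, hx, hxe⟩, he⟩, hef⟩
      exact ⟨⟨x, hx, hxe.trans ((sle_iff_ele he).2 hef)⟩, hf⟩
    · exact fun hf => ⟨hf.2, f, hf, hf.2.symm⟩
  · intro e he f hf
    obtain ⟨hE, a, ha, hae⟩ := (mem_src_inter_E_iff hF').1 he
    obtain ⟨hE', b, hb, hbf⟩ := (mem_src_inter_E_iff hF').1 hf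
    obtain ⟨c, hc, hca, hcb⟩ := hF'.2.2 a ha b hb
    refine ⟨_, hF'.inv_mul_self_mem_src hc, ?_, ?_⟩
    · exact (sle_iff_ele (inv_mul_self_mem_E c)).1
        ((hca.inv_mul_le hca).trans ((sle_iff_ele (inv_mul_self_mem_E a)).2 hae))
    · exact (sle_iff_ele (inv_mul_self_mem_E c)).1
        ((hcb.inv_mul_le hcb).trans ((sle_iff_ele (inv_mul_self_mem_E b)).2 hbf))
  · intro h0
    obtain ⟨-, a, ha, ha0⟩ := (mem_src_inter_E_iff hF').1 h0
    have h : a⁻¹ * a = 0 := by rw [ha0, mul_zero]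
    have ha' : a = 0 := by rw [← mul_inv_mul a, mul_assoc, h, mul_zero]
    exact hF.2 (ha' ▸ ha)

theorem src_mono {F G : Set S} (h : F ⊆ G) : src F ⊆ src G := by
  rintro x ⟨y, ⟨_, ⟨a, ha, rfl⟩, b, hb, rfl⟩, hy⟩
  exact ⟨_, ⟨_, ⟨a, h ha, rfl⟩, b, h hb, rfl⟩, hy⟩

/-- A filter containing `F` with the same source idempotents as `F` is contained in `F`. -/
theorem subset_of_src_inter_E_eq {F G : Set S} (hF : IsFilt F) (hG : IsFilt G) (hFG : F ⊆ G)
    (h : src F ∩ E S = src G ∩ E S) : G ⊆ F := by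
  intro g hg
  obtain ⟨c, hc⟩ := hF.1
  obtain ⟨k, hk, hkg, hkc⟩ := hG.2.2 g hg c (hFG hc)
  have hkF : k⁻¹ * k ∈ src F ∩ E S := h ▸ hG.inv_mul_self_mem_src hk
  obtain ⟨hkE, b, hb, hbk⟩ := (mem_src_inter_E_iff hF).1 hkF
  obtain ⟨d, hd, hdb, hdc⟩ := hF.2.2 b hb c hc
  have hdE := inv_mul_self_mem_E d
  have hdk : d⁻¹ * d = d⁻¹ * d * (k⁻¹ * k) := (sle_iff_ele hdE).1
    ((hdb.inv_mul_le hdb).trans ((sle_iff_ele (inv_mul_self_mem_E b)).2 hbk))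
  have hd_eq : d = k * (d⁻¹ * d) := by
    calc d = c * (d⁻¹ * d) := hdc.eq_mul_inv_mul
      _ = c * (k⁻¹ * k) * (d⁻¹ * d) := by
          rw [mul_assoc c, ← mul_comm_of_mem_E hdE hkE, ← hdk]
      _ = k * (d⁻¹ * d) := by rw [← hkc.eq_mul_inv_mul]
  have hle : sle d k := by
    rw [hd_eq]
    exact sle_mul_right hdE k
  rw [← hF.2.1]
  exact ⟨d, hd, hle.trans hkg⟩

end InvSemigroupWithZero

/-- If `F` is a proper filter such that `d(F) ∩ E` is an `E`-ultrafilter,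
then `F` is an ultrafilter. -/
theorem stmt_17 {S : Type*} [InvSemigroupWithZero S]
    (F : Set S) (hF : IsPFilt F) (h : IsEUltra (src F ∩ E S)) : IsUltra F := by
  refine ⟨hF, fun G hG hFG => hFG.antisymm ?_⟩
  exact subset_of_src_inter_E_eq hF.1 hG.1 hFG
    (h.2 _ hG.isEFilt_src (Set.inter_subset_inter_left _ (src_mono hFG)))
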